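/- Let A be a unital C*-algebra, let p ∈ A be a projection, and let v_1, …, v_n ∈ A be partial isometries such that v_i* v_i ≤ p for each i and v_1 v_1* + ⋯ + v_n v_n* = 1 − p. Let H be a complex Hilbert space and let π₀ : pAp → B(H) be a *-homomorphism on the corner C*-algebra pAp = {p a p : a ∈ A} with π₀(p) = 1_H. Then there exist a complex Hilbert space K, a linear isometry u : H → K, and a unital *-homomorphism ρ : A → B(K) such that ρ(p) = u u* (the orthogonal projection of K onto the range of u) and ρ(x) u ξ = u π₀(x) ξ for every x ∈ pAp and every ξ ∈ H. -/

import Mathlib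

/-- The corner `pAp = {p a p : a ∈ A}` of a C*-algebra `A`, as a non-unital
*-subalgebra. -/
def corner (A : Type*) [CStarAlgebra A] (p : A) (hp : IsSelfAdjoint p ∧ p * p = p) :
    NonUnitalStarSubalgebra ℂ A where
  carrier := {x : A | ∃ a : A, x = p * a * p}
  add_mem' := by
    rintro x y ⟨a, rfl⟩ ⟨b, rfl⟩
    exact ⟨a + b, by noncomm_ring⟩
  zero_mem' := ⟨0, by simp⟩
  mul_mem' := by
    rintro x y ⟨a, rfl⟩ ⟨b, rfl⟩
    exact ⟨a * p * p * b, by noncomm_ring⟩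
  smul_mem' := by
    rintro c x ⟨a, rfl⟩
    exact ⟨c • a, by simp [mul_smul_comm, smul_mul_assoc]⟩
  star_mem' := by
    rintro x ⟨a, rfl⟩
    exact ⟨star a, by simp [star_mul, hp.1.star_eq, mul_assoc]⟩

open ContinuousLinearMap in
/-- A star projection `q` on a Hilbert space factors as `J J*` for an isometry `J`. -/
theorem exists_isometry_of_isStarProjection.{u} {G : Type u} [NormedAddCommGroup G]
    [InnerProductSpace ℂ G] [CompleteSpace G] {q : G →L[ℂ] G} (hq : IsStarProjection q) :
    ∃ (K : Type u) (_ : NormedAddCommGroup K) (_ : InnerProductSpace ℂ K)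
      (_ : CompleteSpace K) (J : K →L[ℂ] G),
      adjoint J ∘L J = .id ℂ K ∧ J ∘L adjoint J = q := by
  obtain ⟨K, _, rfl⟩ := isStarProjection_iff_eq_starProjection.1 hq
  have hK : IsClosed (K : Set G) := K.orthogonal_orthogonal ▸ Kᗮ.isClosed_orthogonal
  have : CompleteSpace K := hK.completeSpace_coe
  refine ⟨K, inferInstance, inferInstance, this, K.subtypeL, ?_, ?_⟩
  · rw [Submodule.adjoint_subtypeL]
    ext x
    simp
  · rw [Submodule.adjoint_subtypeL]
    rfl

open ContinuousLinearMap in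
/-- A possibly degenerate representation `σ` of a unital *-algebra restricts to a unital
representation on the range of `σ 1`. -/
theorem exists_unital_compression.{u} {A : Type*} [Ring A] [StarRing A] [Algebra ℂ A]
    {G : Type u} [NormedAddCommGroup G] [InnerProductSpace ℂ G] [CompleteSpace G]
    (σ : A →⋆ₙₐ[ℂ] (G →L[ℂ] G)) :
    ∃ (K : Type u) (_ : NormedAddCommGroup K) (_ : InnerProductSpace ℂ K)
      (_ : CompleteSpace K) (J : K →L[ℂ] G) (ρ : A →⋆ₐ[ℂ] (K →L[ℂ] K)),
      J ∘L adjoint J = σ 1 ∧ ∀ a, ρ a = adjoint J ∘L σ a ∘L J := by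
  have hq : IsStarProjection (σ 1) :=
    ⟨by rw [IsIdempotentElem, ← map_mul, one_mul], by
      rw [IsSelfAdjoint, ← map_star, star_one]⟩
  obtain ⟨K, _, _, _, J, hJ, hJ'⟩ := exists_isometry_of_isStarProjection hq
  have hone (a : A) : σ 1 ∘L σ a = σ a := by
    rw [← mul_def, ← map_mul, one_mul]
  have hmap_one : adjoint J ∘L σ 1 ∘L J = 1 := by
    rw [← hJ', comp_assoc, hJ, comp_id, hJ]
    rfl
  refine ⟨K, ‹_›, ‹_›, ‹_›, J,
    { toFun a := adjoint J ∘L σ a ∘L J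
      map_one' := hmap_one
      map_mul' a b := ?_
      map_zero' := by simp
      map_add' a b := by simp [add_comp, comp_add]
      commutes' c := ?_
      map_star' a := ?_ }, hJ', fun _ ↦ rfl⟩
  · calc adjoint J ∘L σ (a * b) ∘L J = adjoint J ∘L σ a ∘L (σ 1 ∘L σ b) ∘L J := by
          rw [hone, map_mul, mul_def, comp_assoc]
      _ = (adjoint J ∘L σ a ∘L J) * (adjoint J ∘L σ b ∘L J) := by
          rw [← hJ', mul_def]
          simp only [comp_assoc]
  · rw [Algebra.algebraMap_eq_smul_one, Algebra.algebraMap_eq_smul_one, map_smul, smul_comp,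
      comp_smul, hmap_one]
  · simp [star_eq_adjoint, map_star, adjoint_comp, comp_assoc]

open ContinuousLinearMap in
/-- A finite Hilbert space direct sum of copies of `H`, with its coordinate isometries. -/
theorem exists_coordinate_isometries.{u} (ι : Type) [Fintype ι] [DecidableEq ι] (H : Type u)
    [NormedAddCommGroup H] [InnerProductSpace ℂ H] [CompleteSpace H] :
    ∃ (G : Type u) (_ : NormedAddCommGroup G) (_ : InnerProductSpace ℂ G)
      (_ : CompleteSpace G) (E : ι → H →L[ℂ] G),
      ∀ i j, adjoint (E i) ∘L E j = if i = j then .id ℂ H else 0 := by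
  refine ⟨PiLp 2 fun _ : ι ↦ H, inferInstance, inferInstance, inferInstance, fun i ↦
    (PiLp.continuousLinearEquiv 2 ℂ fun _ : ι ↦ H).symm.toContinuousLinearMap ∘L
      ContinuousLinearMap.single ℂ (fun _ : ι ↦ H) i, fun i j ↦ ?_⟩
  ext x
  refine ext_inner_left ℂ fun y ↦ ?_
  rw [comp_apply, adjoint_inner_right, PiLp.inner_apply]
  rw [Finset.sum_eq_single i]
  · by_cases h : i = j
    · subst h
      simp
    · simp [h]
  · intro k _ hk
    simp [hk]
  · simp

open ContinuousLinearMap in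
/-- If `φ` represents the corner `pAp`, and `w` is a finite family with `∑ w_j w_j* = 1` and
`w_j p = w_j`, then `a ↦ (φ (w_j* a w_k))_{j,k}` represents `A` and is intertwined with `φ` by
the isometry `(φ (w_j*))_j`. -/
theorem exists_amplification.{u} {A : Type*} [Ring A] [StarRing A] [Algebra ℂ A]
    {ι : Type} [Fintype ι] {H : Type u} [NormedAddCommGroup H] [InnerProductSpace ℂ H]
    [CompleteSpace H] {p : A} {w : ι → A} (hw : ∑ j, w j * star (w j) = 1)
    (hwp : ∀ j, w j * p = w j) (φ : A →ₗ[ℂ] (H →L[ℂ] H)) (hφ_one : φ 1 = 1)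
    (hφ_mul : ∀ a b, φ a ∘L φ b = φ (a * p * b)) (hφ_star : ∀ a, φ (star a) = adjoint (φ a)) :
    ∃ (G : Type u) (_ : NormedAddCommGroup G) (_ : InnerProductSpace ℂ G)
      (_ : CompleteSpace G) (σ : A →⋆ₙₐ[ℂ] (G →L[ℂ] G)) (V : H →L[ℂ] G),
      adjoint V ∘L V = .id ℂ H ∧ V ∘L adjoint V = σ p ∧
      σ 1 ∘L V = V ∧ ∀ x, p * x = x → σ x ∘L V = V ∘L φ x := by
  classical
  obtain ⟨G, _, _, _, E, hE⟩ := exists_coordinate_isometries ι H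
  have hsum (a b : A) : ∑ k, a * w k * p * (star (w k) * b) = a * b := by
    calc _ = a * (∑ k, w k * star (w k)) * b := by
          simp only [Finset.mul_sum, Finset.sum_mul, mul_assoc a, hwp]
          simp only [mul_assoc]
      _ = a * b := by rw [hw, mul_one]
  let V (b : A) : H →L[ℂ] G := ∑ k, E k ∘L φ (star (w k) * b)
  let M (a : A) : G →L[ℂ] G := ∑ j, V (a * w j) ∘L adjoint (E j)
  have hEV (j : ι) (b : A) : adjoint (E j) ∘L V b = φ (star (w j) * b) := by
    simp only [V, comp_finsetSum, ← comp_assoc, hE]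
    rw [Finset.sum_eq_single j] <;> simp +contextual [eq_comm]
  have hVφ (a b : A) : V a ∘L φ b = V (a * p * b) := by
    simp only [V, finsetSum_comp, comp_assoc, hφ_mul, mul_assoc]
  have hV_sum {κ : Type} [Fintype κ] (f : κ → A) : ∑ k, V (f k) = V (∑ k, f k) := by
    simp only [V, Finset.mul_sum, map_sum, comp_finsetSum]
    exact Finset.sum_comm
  have hV_smul (c : ℂ) (a : A) : V (c • a) = c • V a := by
    simp [V, Finset.smul_sum]
  have hMV (a b : A) : M a ∘L V b = V (a * b) := by
    simp only [M, finsetSum_comp, comp_assoc, hEV, hVφ, hV_sum, hsum]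
  have hM_mul (a b : A) : M (a * b) = M a ∘L M b := by
    conv_rhs => rw [show M b = ∑ j, V (b * w j) ∘L adjoint (E j) from rfl]
    simp only [comp_finsetSum, ← comp_assoc, hMV]
    simp only [M, mul_assoc]
  have hM_star (a : A) : M (star a) = adjoint (M a) := by
    simp only [M, V, map_sum, adjoint_comp, finsetSum_comp, adjoint_adjoint,
      ← hφ_star, star_mul, star_star, comp_assoc, mul_assoc]
    exact Finset.sum_comm
  have hV_adj : adjoint (V 1) = ∑ k, φ (w k) ∘L adjoint (E k) := by
    simp only [V, map_sum, adjoint_comp, ← hφ_star, mul_one, star_star]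
  refine ⟨G, ‹_›, ‹_›, ‹_›,
    { toFun := M
      map_smul' c a := ?_
      map_zero' := by simp [M, V]
      map_add' a b := ?_
      map_mul' := hM_mul
      map_star' := hM_star }, V 1, ?_, ?_, ?_, ?_⟩
  · simp [M, hV_smul, smul_comp, Finset.smul_sum]
  · simp [M, V, add_mul, mul_add, comp_add, add_comp, Finset.sum_add_distrib]
  · rw [hV_adj]
    simp only [finsetSum_comp, comp_assoc, hEV, hφ_mul, mul_one]
    rw [← map_sum, show ∑ k, w k * p * star (w k) = 1 by simpa only [hwp] using hw, hφ_one]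
    rfl
  · rw [hV_adj]
    simp only [comp_finsetSum, ← comp_assoc, hVφ, one_mul]
    rfl
  · exact (hMV 1 1).trans (by rw [mul_one])
  · intro x hx
    exact (hMV x 1).trans (by rw [hVφ, one_mul, mul_one, hx])

/-- The dilation step in the proof of Lemma 2.2 of the paper: a representation `π₀` of the
corner `pAp` with `π₀(p) = 1` extends, after an isometric embedding `u : H → K`, to a
unital representation `ρ` of all of `A` with `ρ(p) = u u*` and `ρ(x) u ξ = u π₀(x) ξ` for
`x ∈ pAp`. -/
theorem stmt_10.{u} (A : Type*) [CStarAlgebra A] (n : ℕ) (p : A)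
    (hp : IsSelfAdjoint p ∧ p * p = p)
    (v : Fin n → A)
    (hpi : ∀ i, v i * star (v i) * v i = v i)
    (hle : ∀ i, star (v i) * v i * p = star (v i) * v i)
    (hsum : ∑ i, v i * star (v i) = 1 - p)
    (H : Type u) [NormedAddCommGroup H] [InnerProductSpace ℂ H] [CompleteSpace H]
    (π₀ : corner A p hp →⋆ₙₐ[ℂ] (H →L[ℂ] H))
    (hπ₀ : π₀ ⟨p, ⟨1, by rw [mul_one, hp.2]⟩⟩ = 1) :
    ∃ (K : Type u) (_ : NormedAddCommGroup K) (_ : InnerProductSpace ℂ K)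
      (_ : CompleteSpace K) (uem : H →ₗᵢ[ℂ] K) (ρ : A →⋆ₐ[ℂ] (K →L[ℂ] K)),
      ρ p = uem.toContinuousLinearMap ∘L
              ContinuousLinearMap.adjoint uem.toContinuousLinearMap ∧
      ∀ (x : corner A p hp) (ξ : H), ρ (x : A) (uem ξ) = uem (π₀ x ξ) := by
  have hcorner (a : A) : p * a * p ∈ corner A p hp := ⟨a, rfl⟩
  let φ : A →ₗ[ℂ] (H →L[ℂ] H) :=
    { toFun a := π₀ ⟨p * a * p, hcorner a⟩
      map_add' a b := by
        rw [← map_add]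
        congr 1
        ext
        simp [mul_add, add_mul]
      map_smul' c a := by
        rw [RingHom.id_apply, ← map_smul]
        congr 1
        ext
        simp }
  have hφ (x : corner A p hp) : φ x = π₀ x := by
    obtain ⟨_, a, rfl⟩ := x
    refine congrArg π₀ (Subtype.ext ?_)
    calc p * (p * a * p) * p = (p * p) * a * (p * p) := by noncomm_ring
      _ = p * a * p := by rw [hp.2]
  have hφ_one : φ 1 = 1 := by
    rw [← hπ₀]
    exact congrArg π₀ (Subtype.ext (show p * 1 * p = p by rw [mul_one, hp.2]))
  have hφ_mul (a b : A) : φ a ∘L φ b = φ (a * p * b) := by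
    refine (map_mul π₀ _ _).symm.trans (congrArg π₀ (Subtype.ext ?_))
    calc p * a * p * (p * b * p) = p * a * (p * p) * b * p := by noncomm_ring
      _ = p * (a * p * b) * p := by rw [hp.2]; noncomm_ring
  have hφ_star (a : A) : φ (star a) = ContinuousLinearMap.adjoint (φ a) := by
    rw [← ContinuousLinearMap.star_eq_adjoint]
    refine Eq.trans (congrArg π₀ (Subtype.ext ?_)) (map_star π₀ _)
    simp [hp.1.star_eq, mul_assoc]
  have hvp (i : Fin n) : v i * p = v i := by
    calc v i * p = v i * (star (v i) * v i * p) := by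
          conv_lhs => rw [← hpi i]
          simp only [mul_assoc]
      _ = v i := by rw [hle, ← mul_assoc, hpi]
  let w : Option (Fin n) → A := fun o ↦ o.elim p v
  have hw : ∑ j, w j * star (w j) = 1 := by
    simp [w, Fintype.sum_option, hsum, hp.1.star_eq, hp.2]
  have hwp (j : Option (Fin n)) : w j * p = w j := by
    cases j with
    | none => exact hp.2
    | some i => exact hvp i
  obtain ⟨G, _, _, _, σ, V, hVV, hVp, hV1, hVx⟩ :=
    exists_amplification hw hwp φ hφ_one hφ_mul hφ_star
  obtain ⟨K, _, _, _, J, ρ, hJ, hρ⟩ := exists_unital_compression σ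
  let U : H →L[ℂ] K := ContinuousLinearMap.adjoint J ∘L V
  have hJU : J ∘L U = V := by
    rw [← ContinuousLinearMap.comp_assoc, hJ, hV1]
  have hU_adj : ContinuousLinearMap.adjoint U = ContinuousLinearMap.adjoint V ∘L J := by
    simp [U, ContinuousLinearMap.adjoint_comp]
  have hU : ContinuousLinearMap.adjoint U ∘L U = .id ℂ H := by
    rw [hU_adj, ContinuousLinearMap.comp_assoc, hJU, hVV]
  have hU_norm (ξ : H) : ‖U ξ‖ = ‖ξ‖ :=
    U.norm_map_iff_adjoint_comp_self.2 hU ξ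
  refine ⟨K, ‹_›, ‹_›, ‹_›, ⟨U.toLinearMap, hU_norm⟩, ρ, ?_, fun x ξ ↦ ?_⟩
  · change ρ p = U ∘L ContinuousLinearMap.adjoint U
    rw [hρ, ← hVp, hU_adj]
    simp only [U, ContinuousLinearMap.comp_assoc]
  · have hxp : p * (x : A) = x := by
      obtain ⟨_, a, rfl⟩ := x
      change p * (p * a * p) = p * a * p
      rw [← mul_assoc, ← mul_assoc, hp.2]
    have h : ρ x ∘L U = U ∘L π₀ x := by
      rw [hρ, ContinuousLinearMap.comp_assoc, ContinuousLinearMap.comp_assoc, hJU, hVx x hxp, hφ,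
        ← ContinuousLinearMap.comp_assoc]
    exact DFunLike.congr_fun h ξ
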